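/- Let P be a real skew-symmetric 2k×2k matrix (Pᵀ = −P). Then there exist vectors v₁, …, v_{2k} in ℝ^{2k} such that P_{ij} = v_iᵀ R^≻ v_j for all i, j, where R^≻ is the 2k×2k block-diagonal skew-symmetric matrix with k diagonal blocks J = [[0,−1],[1,0]]. (Expressiveness in even dimension via spectral decomposition, Theorem A.3.) -/

import Mathlib

open Matrix

/-- The `2k × 2k` block-diagonal skew-symmetric operator `R^≻` consisting of `k`
diagonal `2 × 2` blocks `J = [[0, -1], [1, 0]]`. -/
def Rsucc (k : ℕ) : Matrix (Fin (2 * k)) (Fin (2 * k)) ℝ :=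
  Matrix.of fun i j =>
    if i.val / 2 = j.val / 2 then
      if i.val % 2 = 0 ∧ j.val % 2 = 1 then -1
      else if i.val % 2 = 1 ∧ j.val % 2 = 0 then 1
      else 0
    else 0

/-- An alternating bilinear form of rank at most `2 * k` is a sum of `k` wedge products of
linear functionals. -/
theorem LinearMap.IsAlt.exists_eq_sum_wedge {K V : Type*} [Field K] [AddCommGroup V] [Module K V]
    [FiniteDimensional K V] {B : V →ₗ[K] V →ₗ[K] K} (hB : B.IsAlt) {k : ℕ}
    (hk : Module.finrank K V ≤ Module.finrank K (LinearMap.ker B) + 2 * k) :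
    ∃ f g : Fin k → Module.Dual K V,
      ∀ x y, B x y = ∑ i, (f i x * g i y - g i x * f i y) := by
  induction k generalizing B with
  | zero =>
    have hker : LinearMap.ker B = ⊤ :=
      Submodule.eq_top_of_finrank_eq (le_antisymm (Submodule.finrank_le _) (by simpa using hk))
    refine ⟨0, 0, fun x y => ?_⟩
    simp [LinearMap.ker_eq_top.mp hker]
  | succ k ih =>
    by_cases hzero : B = 0
    · exact ⟨0, 0, fun x y => by simp [hzero]⟩
    obtain ⟨a, b, hab⟩ : ∃ a b, B a b ≠ 0 := by
      by_contra! h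
      exact hzero (LinearMap.ext₂ h)
    have hneg (x y : V) : B y x = -B x y := (hB.neg x y).symm
    set g₀ : Module.Dual K V := (B a b)⁻¹ • B b with hg₀
    set B' : V →ₗ[K] V →ₗ[K] K := B - ((B a).smulRight g₀ - g₀.smulRight (B a)) with hB'_def
    have hB'_apply (x y : V) : B' x y = B x y - (B a x * g₀ y - g₀ x * B a y) := by
      simp [hB'_def]
    have hB' : B'.IsAlt := fun x => by
      rw [hB'_apply, hB x]
      ring
    have ha : B' a = 0 := by
      ext y
      simp [hB'_apply, hg₀, hB a, hneg a b, hab]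
    have hb : B' b = 0 := by
      ext y
      simp [hB'_apply, hg₀, hB b, hab]
    set L : Submodule K V := LinearMap.ker B' ⊓ LinearMap.ker (B b)
    have hker_lt : LinearMap.ker B < L := by
      refine lt_of_le_of_ne (fun x hx => ?_) fun h => ?_
      · have hx' : B x = 0 := hx
        have hx₀ (y : V) : B y x = 0 := by simp [hneg x y, hx']
        refine ⟨?_, hx₀ b⟩
        refine LinearMap.mem_ker.mpr ?_
        ext y
        simp [hB'_apply, hg₀, hx', hx₀]
      · have hbL : b ∈ L := ⟨hb, hB b⟩
        rw [← h, LinearMap.mem_ker] at hbL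
        exact hab (by simp [hneg b a, hbL])
    have hL_lt : L < LinearMap.ker B' := by
      refine lt_of_le_of_ne inf_le_left fun h => ?_
      have haL : a ∈ L := h ▸ LinearMap.mem_ker.mpr ha
      have hba : B b a = 0 := haL.2
      exact hab (by simp [hneg b a, hba])
    have h₁ := Submodule.finrank_lt_finrank_of_lt hker_lt
    have h₂ := Submodule.finrank_lt_finrank_of_lt hL_lt
    obtain ⟨f, g, hfg⟩ := ih hB' (by omega)
    refine ⟨Fin.cons (B a) f, Fin.cons g₀ g, fun x y => ?_⟩
    simp only [Fin.sum_univ_succ, Fin.cons_zero, Fin.cons_succ]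
    rw [← hfg, hB'_apply]
    ring

/-- The index of entry `r` of block `i` in a vector of `k` blocks of size two. -/
def blockEquiv (k : ℕ) : Fin k × Fin 2 ≃ Fin (2 * k) :=
  finProdFinEquiv.trans (finCongr (mul_comm k 2))

theorem blockEquiv_val {k : ℕ} (p : Fin k × Fin 2) :
    (blockEquiv k p : ℕ) = p.2 + 2 * p.1 := rfl

theorem Rsucc_blockEquiv {k : ℕ} (p q : Fin k × Fin 2) :
    Rsucc k (blockEquiv k p) (blockEquiv k q) =
      if p.1 = q.1 then !![0, -1; 1, 0] p.2 q.2 else 0 := by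
  obtain ⟨i, r⟩ := p
  obtain ⟨j, s⟩ := q
  have hdiv (t : Fin 2) (l : ℕ) : ((t : ℕ) + 2 * l) / 2 = l := by omega
  have hmod (t : Fin 2) (l : ℕ) : ((t : ℕ) + 2 * l) % 2 = t := by omega
  simp only [Rsucc, Matrix.of_apply, blockEquiv_val, hdiv, hmod, Fin.ext_iff]
  fin_cases r <;> fin_cases s <;> simp

theorem dotProduct_Rsucc_mulVec {k : ℕ} (v w : Fin (2 * k) → ℝ) :
    v ⬝ᵥ (Rsucc k *ᵥ w) =
      ∑ i, (v (blockEquiv k (i, 1)) * w (blockEquiv k (i, 0)) -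
        v (blockEquiv k (i, 0)) * w (blockEquiv k (i, 1))) := by
  simp only [dotProduct, mulVec, ← (blockEquiv k).sum_comp, Rsucc_blockEquiv,
    Fintype.sum_prod_type, Fin.sum_univ_two, ite_mul, zero_mul]
  simp [Finset.sum_add_distrib]
  ring

/-- **Theorem A.3 (Expressiveness in even dimension).**
Any real skew-symmetric `2k × 2k` matrix `P` can be written as
`P i j = vᵢᵀ R^≻ vⱼ` for suitable vectors `v₁, …, v_{2k} ∈ ℝ^{2k}` (living in
the same dimension `2k` as `P`). -/
theorem expressiveness_real_even (k : ℕ)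
    (P : Matrix (Fin (2 * k)) (Fin (2 * k)) ℝ) (hP : Pᵀ = -P) :
    ∃ v : Fin (2 * k) → (Fin (2 * k) → ℝ),
      ∀ i j, P i j = v i ⬝ᵥ (Rsucc k *ᵥ v j) := by
  have halt : (Matrix.toBilin' P).IsAlt := by
    intro x
    have h : x ⬝ᵥ (P *ᵥ x) = -(x ⬝ᵥ (P *ᵥ x)) := by
      conv_lhs => rw [dotProduct_mulVec, ← mulVec_transpose, hP, neg_mulVec, neg_dotProduct,
        dotProduct_comm]
    rw [Matrix.toBilin'_apply']
    linarith
  obtain ⟨f, g, hfg⟩ := halt.exists_eq_sum_wedge (k := k) (by simp)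
  refine ⟨fun j p => ![g, f] ((blockEquiv k).symm p).2 ((blockEquiv k).symm p).1
    (Pi.single j 1), fun i j => ?_⟩
  rw [dotProduct_Rsucc_mulVec, ← Matrix.toBilin'_single P i j, hfg]
  simp
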